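/- arXiv:2009.14397 — 2 statements merged into one kernel-verified Lean document; each statement's English description precedes it below -/
import Mathlib

section
/- Fix an integer d ≥ 3, a real c > 0, and a non-integer real γ > 0, and let κ_{c,γ}(u) = exp(−c(1−u)^γ) for u ∈ [−1,1] (the generalized exponential/Laplace-type kernel function on the sphere; γ = 1/2 gives the Laplace kernel e^{−c√(1−u)} up to rescaling of c). Then there exists a nonzero real constant C (depending on d, c, γ) such that μ_k(κ_{c,γ}) · k^{d+2γ−1} → C as k → ∞ (the same limit along even and along odd k); that is, μ_k(κ_{c,γ}) ∼ C · k^{−d−2γ+1}. In particular, for γ = 1/2 the decay is k^{−d}, the same as for the two-layer NTK. -/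
open Filter Asymptotics Real Set Topology

/-- Legendre polynomial of degree `k` in dimension `d` (Rodrigues formula). -/
noncomputable def legendreP (d k : ℕ) (t : ℝ) : ℝ :=
  (-1 / 2 : ℝ) ^ k * (Real.Gamma (((d : ℝ) - 1) / 2) / Real.Gamma ((k : ℝ) + ((d : ℝ) - 1) / 2)) *
    (1 - t ^ 2) ^ ((3 - (d : ℝ)) / 2) *
    iteratedDeriv k (fun s : ℝ => (1 - s ^ 2) ^ ((k : ℝ) + ((d : ℝ) - 3) / 2)) t

/-- Surface area `ω_{p-1}` of the unit sphere in `ℝ^p`. -/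
noncomputable def sphereSurface (p : ℕ) : ℝ :=
  2 * Real.pi ^ ((p : ℝ) / 2) / Real.Gamma ((p : ℝ) / 2)

/-- `μ_k(κ)`, the `k`-th Legendre coefficient of `κ` in dimension `d`. -/
noncomputable def legendreCoeff (d k : ℕ) (κ : ℝ → ℝ) : ℝ :=
  (sphereSurface (d - 1) / sphereSurface d) *
    ∫ t in (-1 : ℝ)..1, κ t * legendreP d k t * (1 - t ^ 2) ^ (((d : ℝ) - 3) / 2)

lemma aux_gamma_prod (y : ℝ) (hy : 0 < y) (n : ℕ) :
    Real.Gamma (y + n) = Real.Gamma y * ∏ j ∈ Finset.range n, (y + j) := by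
  induction n with
  | zero => simp
  | succ n ih =>
    rw [Finset.prod_range_succ, ← mul_assoc, ← ih]
    push_cast
    rw [← add_assoc, Real.Gamma_add_one (by positivity)]
    ring

lemma aux_r_bound (a γ s : ℝ) (ha : 0 ≤ a) (hγ : 0 ≤ γ) (hs : γ ≤ s) (k : ℕ) :
    |∏ i ∈ Finset.range k, ((i : ℝ) - s)| / Real.Gamma (s + k + 2 * a + 2)
        ≤ 1 / Real.Gamma (s + 2 * a + 2) ∧
    |∏ i ∈ Finset.range k, ((i : ℝ) - s)| / Real.Gamma (s + k + 2 * a + 2)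
        * (k + (γ + 2 * a + 1)) ^ (2 * γ + 2 * a + 2)
      ≤ (s + 1 + (γ + 2 * a + 1)) ^ (2 * γ + 2 * a + 2) / Real.Gamma (s + 2 * a + 2) := by
  have hs0 : 0 ≤ s := hγ.trans hs
  have hG : 0 < Real.Gamma (s + 2 * a + 2) := Real.Gamma_pos_of_pos (by positivity)
  induction k with
  | zero =>
    simp only [Finset.range_zero, Finset.prod_empty, abs_one, Nat.cast_zero, add_zero, le_refl,
      true_and]
    rw [one_div_mul_eq_div]
    gcongr
    linarith
  | succ k ih =>
    obtain ⟨ih1, ih2⟩ := ih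
    set r := |∏ i ∈ Finset.range k, ((i : ℝ) - s)| / Real.Gamma (s + k + 2 * a + 2) with hr
    have hk0 : (0 : ℝ) ≤ k := Nat.cast_nonneg k
    have hGk : 0 < Real.Gamma (s + k + 2 * a + 2) := Real.Gamma_pos_of_pos (by positivity)
    have hr0 : 0 ≤ r := by positivity
    have hstep : |∏ i ∈ Finset.range (k + 1), ((i : ℝ) - s)| /
        Real.Gamma (s + (k + 1 : ℕ) + 2 * a + 2) = r * (|(k : ℝ) - s| / (s + k + 2 * a + 2)) := by
      rw [Finset.prod_range_succ, abs_mul]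
      have : s + ((k + 1 : ℕ) : ℝ) + 2 * a + 2 = (s + k + 2 * a + 2) + 1 := by push_cast; ring
      rw [this, Real.Gamma_add_one (by positivity), hr]
      have : s + k + 2 * a + 2 ≠ 0 := by positivity
      field_simp
    have hq : |(k : ℝ) - s| / (s + k + 2 * a + 2) ≤ 1 := by
      rw [div_le_one (by positivity), abs_le]
      constructor <;> linarith
    have hq0 : 0 ≤ |(k : ℝ) - s| / (s + k + 2 * a + 2) := by positivity
    rw [hstep]
    have h1 : r * (|(k : ℝ) - s| / (s + k + 2 * a + 2)) ≤ r := mul_le_of_le_one_right hr0 hq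
    refine ⟨h1.trans ih1, ?_⟩
    rcases le_or_gt s k with hsk | hsk
    · refine le_trans ?_ ih2
      rw [mul_assoc]
      refine mul_le_mul_of_nonneg_left ?_ hr0
      rw [abs_of_nonneg (by linarith)]
      set p := 2 * γ + 2 * a + 2 with hp
      set B := (k : ℝ) + 1 + (γ + 2 * a + 1) with hB
      have hBpos : 0 < B := by positivity
      have e1 : ((k : ℝ) - s) / (s + k + 2 * a + 2) ≤ 1 + p * (-1 / B) := by
        have : 1 + p * (-1 / B) = ((k : ℝ) - γ) / B := by
          field_simp
          rw [hB, hp]; ring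
        rw [this]
        apply div_le_div₀ <;> linarith
      have e2 : 1 + p * (-1 / B) ≤ (1 + (-1 / B)) ^ p := by
        apply one_add_mul_self_le_rpow_one_add
        · rw [le_div_iff₀ hBpos]; linarith
        · linarith
      have e3 : (1 + (-1 / B)) = ((k : ℝ) + (γ + 2 * a + 1)) / B := by
        field_simp
        rw [hB]; ring
      rw [e3, Real.div_rpow (by positivity) hBpos.le] at e2
      have hBp : 0 < B ^ p := Real.rpow_pos_of_pos hBpos p
      have := e1.trans e2
      rw [le_div_iff₀ hBp] at this
      push_cast
      exact this
    · calc r * (|(k : ℝ) - s| / (s + k + 2 * a + 2)) *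
            (((k + 1 : ℕ) : ℝ) + (γ + 2 * a + 1)) ^ (2 * γ + 2 * a + 2)
          ≤ (1 / Real.Gamma (s + 2 * a + 2)) * (s + 1 + (γ + 2 * a + 1)) ^ (2 * γ + 2 * a + 2) := by
            apply mul_le_mul (h1.trans ih1) _ (by positivity) (by positivity)
            apply Real.rpow_le_rpow (by positivity) _ (by positivity)
            push_cast; linarith
        _ = _ := by ring

lemma aux_limit (γ y : ℝ) (hy : 0 < y) (hγ : ∀ n : ℤ, γ ≠ (n : ℝ)) :
    Tendsto (fun k : ℕ => (∏ i ∈ Finset.range k, ((i : ℝ) - γ)) / Real.Gamma (y + k)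
      * (k : ℝ) ^ (γ + y)) atTop (𝓝 (1 / Real.Gamma (-γ))) := by
  have hG : Real.Gamma (-γ) ≠ 0 := Real.Gamma_ne_zero fun m h => hγ m (by simpa using h)
  have hy' := Real.Gamma_pos_of_pos hy
  rw [← tendsto_add_atTop_iff_nat 1]
  have h1 := (((Real.GammaSeq_tendsto_Gamma y).div (Real.GammaSeq_tendsto_Gamma (-γ)) hG).div_const
    (Real.Gamma y))
  have h2 : Tendsto (fun n : ℕ => (((n : ℝ) + 1) / n) ^ (γ + y)) atTop (𝓝 1) := by
    have : Tendsto (fun n : ℕ => (((n : ℝ) + 1) / n)) atTop (𝓝 1) := by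
      have h3 := (tendsto_natCast_div_add_atTop (1 : ℝ)).inv₀ one_ne_zero
      simpa using h3
    simpa using this.rpow_const (p := γ + y) (Or.inl one_ne_zero)
  have h3 := h1.mul h2
  have e : Real.Gamma y / Real.Gamma (-γ) / Real.Gamma y * 1 = 1 / Real.Gamma (-γ) := by
    field_simp
  rw [e] at h3
  refine h3.congr' ?_
  filter_upwards [eventually_ge_atTop 1] with n hn
  have hn' : (0 : ℝ) < n := by exact_mod_cast hn
  have hQ : ∏ i ∈ Finset.range (n + 1), ((i : ℝ) - γ) ≠ 0 := by
    rw [Finset.prod_ne_zero_iff]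
    intro i _ h
    exact hγ i (by push_cast; linarith)
  have hQy : 0 < ∏ i ∈ Finset.range (n + 1), (y + (i : ℝ)) :=
    Finset.prod_pos fun i _ => by positivity
  rw [aux_gamma_prod y hy]
  simp only [Pi.div_apply, Real.GammaSeq]
  have e2 : ∏ i ∈ Finset.range (n + 1), (-γ + (i : ℝ)) = ∏ i ∈ Finset.range (n + 1), ((i : ℝ) - γ) :=
    Finset.prod_congr rfl fun i _ => by ring
  rw [e2, Real.div_rpow (by positivity) hn'.le, Real.rpow_add hn', Real.rpow_neg hn'.le]
  have := Real.rpow_pos_of_pos hn' γ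
  have := Real.rpow_pos_of_pos hn' y
  have : (n.factorial : ℝ) ≠ 0 := by positivity
  push_cast
  field_simp

lemma aux_beta (x y : ℝ) (hx : 0 ≤ x) (hy : 0 ≤ y) :
    ∫ t in (-1 : ℝ)..1, (1 - t) ^ x * (1 + t) ^ y =
      2 ^ (x + y + 1) * (Real.Gamma (x + 1) * Real.Gamma (y + 1) / Real.Gamma (x + y + 2)) := by
  have h := ProbabilityTheory.beta_eq_betaIntegralReal (y + 1) (x + 1) (by positivity) (by positivity)
  have h2 : (Complex.betaIntegral ((y + 1 : ℝ) : ℂ) ((x + 1 : ℝ) : ℂ)) =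
      ((∫ u in (0 : ℝ)..1, u ^ y * (1 - u) ^ x : ℝ) : ℂ) := by
    rw [Complex.betaIntegral, ← intervalIntegral.integral_ofReal]
    apply intervalIntegral.integral_congr
    intro u hu
    rw [Set.uIcc_of_le zero_le_one] at hu
    simp only [Complex.ofReal_mul]
    rw [Complex.ofReal_cpow hu.1, Complex.ofReal_cpow (by linarith [hu.2])]
    push_cast
    congr 2 <;> ring
  rw [h2, Complex.ofReal_re, ProbabilityTheory.beta] at h
  have h3 := intervalIntegral.integral_comp_mul_sub (a := 0) (b := 1)
    (fun t : ℝ => (1 - t) ^ x * (1 + t) ^ y) (two_ne_zero) 1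
  norm_num at h3
  have h4 : ∫ u in (0 : ℝ)..1, (1 - (2 * u - 1)) ^ x * (2 * u) ^ y =
      2 ^ (x + y) * ∫ u in (0 : ℝ)..1, u ^ y * (1 - u) ^ x := by
    rw [← intervalIntegral.integral_const_mul]
    apply intervalIntegral.integral_congr
    intro u hu
    rw [Set.uIcc_of_le zero_le_one] at hu
    have : 1 - (2 * u - 1) = 2 * (1 - u) := by ring
    simp only
    rw [this, Real.mul_rpow two_pos.le (by linarith [hu.2]), Real.mul_rpow two_pos.le hu.1,
      Real.rpow_add two_pos]
    ring
  rw [h4, ← h] at h3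
  have h5 : ∫ t in (-1 : ℝ)..1, (1 - t) ^ x * (1 + t) ^ y = 2 * (2 ^ (x + y) *
    (Real.Gamma (y + 1) * Real.Gamma (x + 1) / Real.Gamma (y + 1 + (x + 1)))) := by
    rw [h3]; ring
  rw [h5, Real.rpow_add_one two_ne_zero, show y + 1 + (x + 1) = x + y + 2 by ring]
  ring

/-- Polynomial factor of the iterated derivatives of `(1 - t²)^β`. -/
noncomputable def auxQ (β : ℝ) : ℕ → Polynomial ℝ
  | 0 => 1
  | i + 1 => Polynomial.derivative (auxQ β i) * (1 - Polynomial.X ^ 2)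
      - Polynomial.C (2 * (β - i)) * Polynomial.X * auxQ β i

lemma auxQ_eval_succ (β : ℝ) (i : ℕ) (t : ℝ) : (auxQ β (i + 1)).eval t =
    (Polynomial.derivative (auxQ β i)).eval t * (1 - t ^ 2) - 2 * (β - i) * t * (auxQ β i).eval t := by
  simp [auxQ]

lemma aux_iter (β : ℝ) (i : ℕ) : ∀ t ∈ Ioo (-1 : ℝ) 1,
    iteratedDeriv i (fun s : ℝ => (1 - s ^ 2) ^ β) t =
      (auxQ β i).eval t * (1 - t ^ 2) ^ (β - i) := by
  induction i with
  | zero => intro t _; simp [auxQ]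
  | succ i ih =>
    intro t ht
    rw [iteratedDeriv_succ]
    have hev : iteratedDeriv i (fun s : ℝ => (1 - s ^ 2) ^ β) =ᶠ[𝓝 t]
        fun t => (auxQ β i).eval t * (1 - t ^ 2) ^ (β - i) := by
      filter_upwards [isOpen_Ioo.mem_nhds ht] with u hu using ih u hu
    rw [hev.deriv_eq]
    have hpos : 0 < 1 - t ^ 2 := by nlinarith [ht.1, ht.2]
    have h1 : HasDerivAt (fun t : ℝ => 1 - t ^ 2) (-(2 * t)) t := by
      simpa using (hasDerivAt_pow 2 t).const_sub 1
    have h2 := ((auxQ β i).hasDerivAt t).mul (h1.rpow_const (p := β - i) (Or.inl hpos.ne'))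
    refine h2.deriv.trans ?_
    rw [auxQ_eval_succ]
    push_cast
    have e : (1 - t ^ 2) ^ (β - i) = (1 - t ^ 2) ^ (β - (i + 1)) * (1 - t ^ 2) := by
      rw [← Real.rpow_add_one hpos.ne']; congr 1; ring
    rw [e, show β - (i : ℝ) - 1 = β - (i + 1) by ring]
    ring

lemma aux_cont (q : Polynomial ℝ) (x y : ℝ) (hx : 0 ≤ x) (hy : 0 ≤ y) :
    Continuous (fun t : ℝ => q.eval t * (1 - t) ^ x * (1 + t) ^ y) := by
  refine (q.continuous.mul ?_).mul ?_
  · exact (continuous_const.sub continuous_id).rpow_const fun _ => Or.inr hx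
  · exact (continuous_const.add continuous_id).rpow_const fun _ => Or.inr hy

lemma aux_ibp (β e : ℝ) (he : 0 ≤ e) (i : ℕ) (hi : (i : ℝ) + 1 ≤ β) :
    ∫ t in (-1 : ℝ)..1, (auxQ β (i + 1)).eval t * (1 - t) ^ e * (1 + t) ^ (β - (i + 1 : ℕ)) =
      (e + 1 + i - β) * ∫ t in (-1 : ℝ)..1, (auxQ β i).eval t * (1 - t) ^ e * (1 + t) ^ (β - i) := by
  have c1 := aux_cont (auxQ β (i + 1)) e (β - (i + 1 : ℕ)) he (by push_cast; linarith)
  have c2 := aux_cont (auxQ β i) e (β - i) he (by linarith)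
  have c3 := aux_cont (auxQ β i) (e + 1) (β - i) (by linarith) (by linarith)
  rw [← intervalIntegral.integral_const_mul, ← sub_eq_zero, ← intervalIntegral.integral_sub
    (c1.intervalIntegrable _ _) ((c2.const_mul _).intervalIntegrable _ _)]
  rw [intervalIntegral.integral_eq_sub_of_hasDerivAt_of_le (by norm_num) c3.continuousOn
    (f := fun t => (auxQ β i).eval t * (1 - t) ^ (e + 1) * (1 + t) ^ (β - i))]
  · have h1 : (0 : ℝ) ^ (e + 1) = 0 := Real.zero_rpow (by linarith)
    have h2 : (0 : ℝ) ^ (β - i) = 0 := Real.zero_rpow (by linarith)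
    simp [h1, h2]
  · intro t ht
    have p1 : 0 < 1 - t := by linarith [ht.2]
    have p2 : 0 < 1 + t := by linarith [ht.1]
    have d1 : HasDerivAt (fun t : ℝ => 1 - t) (-1) t := by
      simpa using (hasDerivAt_id t).const_sub 1
    have d2 : HasDerivAt (fun t : ℝ => 1 + t) 1 t := by
      simpa using (hasDerivAt_id t).const_add 1
    have := (((auxQ β i).hasDerivAt t).mul (d1.rpow_const (p := e + 1) (Or.inl p1.ne'))).mul
      (d2.rpow_const (p := β - i) (Or.inl p2.ne'))
    refine this.congr_deriv ?_
    rw [auxQ_eval_succ]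
    push_cast
    have e1 : (1 + t) ^ (β - i) = (1 + t) ^ (β - (i + 1)) * (1 + t) := by
      rw [← Real.rpow_add_one p2.ne']; congr 1; ring
    have e2 : (1 - t) ^ (e + 1) = (1 - t) ^ e * (1 - t) := Real.rpow_add_one p1.ne' e
    simp only [Pi.mul_apply]
    rw [e1, e2, show β - (i : ℝ) - 1 = β - (i + 1) by ring, show e + 1 - 1 = e by ring]
    ring
  · exact (c1.sub (c2.const_mul _)).intervalIntegrable _ _

lemma aux_int (β e : ℝ) (he : 0 ≤ e) (k : ℕ) (hk : (k : ℝ) ≤ β) :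
    ∫ t in (-1 : ℝ)..1, (auxQ β k).eval t * (1 - t) ^ e * (1 + t) ^ (β - k) =
      (∏ i ∈ Finset.range k, (e + 1 + i - β)) * (2 ^ (e + β + 1) *
        (Real.Gamma (e + 1) * Real.Gamma (β + 1) / Real.Gamma (e + β + 2))) := by
  induction k with
  | zero =>
    rw [← aux_beta e β he (by simpa using hk)]
    simp [auxQ]
  | succ k ih =>
    push_cast at hk
    rw [aux_ibp β e he k hk, ih (by linarith), Finset.prod_range_succ]
    ring

lemma aux_moment (a s : ℝ) (ha : 0 ≤ a) (hs : 0 ≤ s) (k : ℕ) :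
    (-1 / 2 : ℝ) ^ k * (Real.Gamma (a + 1) / Real.Gamma (k + a + 1)) *
    ∫ t in (-1 : ℝ)..1, (auxQ (k + a) k).eval t * (1 - t) ^ (s + a) * (1 + t) ^ a =
      Real.Gamma (a + 1) * 2 ^ (2 * a + 1) * (2 ^ s * Real.Gamma (s + a + 1) *
        ((∏ i ∈ Finset.range k, ((i : ℝ) - s)) / Real.Gamma (s + k + 2 * a + 2))) := by
  have h := aux_int (k + a) (s + a) (by positivity) k (by linarith)
  rw [show (k : ℝ) + a - k = a by ring] at h
  rw [h]
  have hp : ∏ i ∈ Finset.range k, (s + a + 1 + (i : ℝ) - (k + a)) =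
      (-1) ^ k * ∏ i ∈ Finset.range k, ((i : ℝ) - s) := by
    rw [← Finset.prod_range_reflect]
    have : ((-1 : ℝ)) ^ k = ∏ i ∈ Finset.range k, (-1 : ℝ) := by simp
    rw [this, ← Finset.prod_mul_distrib]
    refine Finset.prod_congr rfl fun i hi => ?_
    have hi' := Finset.mem_range.mp hi
    rw [Nat.sub_sub, Nat.cast_sub (by omega)]
    push_cast; ring
  rw [hp, show s + a + (k + a) + 1 = s + (2 * a + 1) + k by ring, Real.rpow_add two_pos,
    Real.rpow_add two_pos, Real.rpow_natCast,
    show s + a + (k + a) + 2 = s + k + 2 * a + 2 by ring]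
  have hg : Real.Gamma (k + a + 1) ≠ 0 := (Real.Gamma_pos_of_pos (by positivity)).ne'
  have h2 : (-1 / 2 : ℝ) ^ k * (-1) ^ k * 2 ^ k = 1 := by
    rw [← mul_pow, ← mul_pow]; norm_num
  have hg2 : Real.Gamma (s + k + 2 * a + 2) ≠ 0 := (Real.Gamma_pos_of_pos (by positivity)).ne'
  field_simp
  linear_combination (∏ i ∈ Finset.range k, ((i : ℝ) - s)) * h2

/-- The Legendre coefficient of `(1-t)^s`, up to a constant. -/
noncomputable def auxT (a s : ℝ) (k : ℕ) : ℝ :=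
  2 ^ s * Real.Gamma (s + a + 1) *
        ((∏ i ∈ Finset.range k, ((i : ℝ) - s)) / Real.Gamma (s + k + 2 * a + 2))

lemma aux_series (a c γ : ℝ) (ha : 0 ≤ a) (hc : 0 < c) (hγ : 0 < γ) (k : ℕ) :
    (-1 / 2 : ℝ) ^ k * (Real.Gamma (a + 1) / Real.Gamma (k + a + 1)) *
    ∫ t in (-1 : ℝ)..1, Real.exp (-c * (1 - t) ^ γ) *
      ((auxQ (k + a) k).eval t * (1 - t) ^ a * (1 + t) ^ a) =
    Real.Gamma (a + 1) * 2 ^ (2 * a + 1) *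
      ∑' j : ℕ, (-c) ^ j / (j.factorial : ℝ) * auxT a (γ * j) k := by
  set W : ℝ → ℝ := fun t => (auxQ (k + a) k).eval t * (1 - t) ^ a * (1 + t) ^ a with hW
  have hWc : Continuous W := aux_cont _ a a ha ha
  have hgc : Continuous (fun t : ℝ => (1 - t) ^ γ) :=
    (continuous_const.sub continuous_id).rpow_const fun _ => Or.inr hγ.le
  have hexp : ∀ x : ℝ, HasSum (fun j : ℕ => x ^ j / (j.factorial : ℝ)) (Real.exp x) := by
    intro x
    rw [Real.exp_eq_exp_ℝ]
    exact NormedSpace.expSeries_div_hasSum_exp x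
  have hs := intervalIntegral.hasSum_integral_of_dominated_convergence (μ := MeasureTheory.volume)
    (a := -1) (b := 1)
    (F := fun (j : ℕ) t => (-c * (1 - t) ^ γ) ^ j / (j.factorial : ℝ) * W t)
    (f := fun t => Real.exp (-c * (1 - t) ^ γ) * W t)
    (bound := fun (j : ℕ) t => (c * 2 ^ γ) ^ j / (j.factorial : ℝ) * |W t|)
    (fun j => ((((continuous_const.mul hgc).pow j).div_const _).mul hWc).aestronglyMeasurable)
    (fun j => Eventually.of_forall fun t ht => by
      rw [Set.uIoc_of_le (by norm_num)] at ht
      rw [norm_mul, Real.norm_eq_abs, Real.norm_eq_abs, abs_div, abs_pow, abs_mul, abs_neg,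
        abs_of_pos hc, Nat.abs_cast]
      have h0 : 0 ≤ 1 - t := by linarith [ht.2]
      rw [abs_of_nonneg (Real.rpow_nonneg h0 γ)]
      gcongr
      linarith [ht.1])
    (Eventually.of_forall fun t ht => (hexp _).summable.mul_right _)
    (by
      have : (fun t => ∑' (j : ℕ), (c * 2 ^ γ) ^ j / (j.factorial : ℝ) * |W t|) =
          fun t => Real.exp (c * 2 ^ γ) * |W t| := by
        funext t
        rw [tsum_mul_right, (hexp _).tsum_eq]
      rw [this]
      exact (continuous_const.mul hWc.abs).intervalIntegrable _ _)
    (Eventually.of_forall fun t ht => (hexp _).mul_right _)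
  rw [← hs.tsum_eq, ← tsum_mul_left, ← tsum_mul_left]
  refine tsum_congr fun j => ?_
  have hm := aux_moment a (γ * j) ha (by positivity) k
  have hI : ∫ t in (-1 : ℝ)..1, (-c * (1 - t) ^ γ) ^ j / (j.factorial : ℝ) * W t =
      (-c) ^ j / (j.factorial : ℝ) *
      ∫ t in (-1 : ℝ)..1, (auxQ (k + a) k).eval t * (1 - t) ^ (γ * j + a) * (1 + t) ^ a := by
    rw [← intervalIntegral.integral_const_mul]
    refine intervalIntegral.integral_congr_Ioo_of_le (by norm_num) fun t ht => ?_
    have h0 : 0 < 1 - t := by linarith [ht.2]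
    simp only [hW]
    rw [Real.rpow_add h0, Real.rpow_mul h0.le, Real.rpow_natCast, mul_pow]
    ring
  rw [hI, auxT]
  linear_combination (-c) ^ j / (j.factorial : ℝ) * hm

lemma aux_coeff (d : ℕ) (hd : 3 ≤ d) (c γ : ℝ) (hc : 0 < c) (hγ : 0 < γ) :
    ∃ K : ℝ, K ≠ 0 ∧ ∀ k : ℕ, legendreCoeff d k (fun u => Real.exp (-c * (1 - u) ^ γ)) =
      K * ∑' j : ℕ, (-c) ^ j / (j.factorial : ℝ) * auxT (((d : ℝ) - 3) / 2) (γ * j) k := by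
  have hd' : (3 : ℝ) ≤ d := by exact_mod_cast hd
  obtain ⟨a, ha_def⟩ : ∃ a : ℝ, a = ((d : ℝ) - 3) / 2 := ⟨_, rfl⟩
  have ha : 0 ≤ a := by rw [ha_def]; linarith
  have hS : ∀ p : ℕ, 0 < p → 0 < sphereSurface p := fun p hp => by
    have : (0 : ℝ) < p := by exact_mod_cast hp
    have := Real.Gamma_pos_of_pos (half_pos this)
    rw [sphereSurface]; positivity
  have h1 := hS (d - 1) (by omega)
  have h2 := hS d (by omega)
  have h3 := Real.Gamma_pos_of_pos (by positivity : 0 < a + 1)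
  refine ⟨(sphereSurface (d - 1) / sphereSurface d) * (Real.Gamma (a + 1) * 2 ^ (2 * a + 1)),
    by positivity, fun k => ?_⟩
  rw [legendreCoeff, mul_assoc, ← ha_def, ← aux_series a c γ ha hc hγ k]
  congr 1
  rw [← intervalIntegral.integral_const_mul]
  refine intervalIntegral.integral_congr_Ioo_of_le (by norm_num) fun t ht => ?_
  have p1 : 0 < 1 - t := by linarith [ht.2]
  have p2 : 0 < 1 + t := by linarith [ht.1]
  have hpos : 0 < 1 - t ^ 2 := by nlinarith
  simp only [legendreP]
  rw [← ha_def, aux_iter _ _ t ht, show ((d : ℝ) - 1) / 2 = a + 1 by rw [ha_def]; ring,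
    show (3 - (d : ℝ)) / 2 = -a by rw [ha_def]; ring, show (k : ℝ) + a - k = a by ring,
    ← add_assoc, Real.rpow_neg hpos.le]
  have hpa := Real.rpow_pos_of_pos hpos a
  have e : (1 - t ^ 2) ^ a = (1 - t) ^ a * (1 + t) ^ a := by
    rw [← Real.mul_rpow p1.le p2.le]; congr 1; ring
  have e2 : ((1 - t ^ 2) ^ a)⁻¹ * (1 - t ^ 2) ^ a = 1 := inv_mul_cancel₀ hpa.ne'
  have : ∀ E G Q w : ℝ, w⁻¹ * w = 1 → E * (G * w⁻¹ * (Q * w)) * w = G * (E * (Q * w)) := by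
    intro E G Q w hw
    linear_combination (E * G * Q * w) * hw
  rw [this _ _ _ _ e2, e]
  ring

lemma aux_T_bound (a γ s : ℝ) (ha : 0 ≤ a) (hγ : 0 ≤ γ) (hs : γ ≤ s) (k : ℕ) :
    |auxT a s k| * (k : ℝ) ^ (2 * γ + 2 * a + 2) ≤
      2 ^ s * (s + 1 + (γ + 2 * a + 1)) ^ (2 * γ + 2 * a + 2) := by
  have hs0 : 0 ≤ s := hγ.trans hs
  have hk0 : (0 : ℝ) ≤ k := Nat.cast_nonneg k
  have hb := (aux_r_bound a γ s ha hγ hs k).2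
  have hG1 : 0 < Real.Gamma (s + a + 1) := Real.Gamma_pos_of_pos (by positivity)
  have hG2 : 0 < Real.Gamma (s + 2 * a + 2) := Real.Gamma_pos_of_pos (by positivity)
  have hG3 : 0 < Real.Gamma (s + k + 2 * a + 2) := Real.Gamma_pos_of_pos (by positivity)
  have hle : Real.Gamma (s + a + 1) ≤ Real.Gamma (s + 2 * a + 2) := by
    have h1 : Real.Gamma (s + a + 1) ≤ Real.Gamma (s + a + 1 + 1) := by
      rw [Real.Gamma_add_one (s := s + a + 1) (by positivity)]
      exact le_mul_of_one_le_left hG1.le (by linarith)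
    refine h1.trans (Real.Gamma_strictMonoOn_Ici.monotoneOn ?_ ?_ ?_)
    · simp only [Set.mem_Ici]; linarith
    · simp only [Set.mem_Ici]; linarith
    · linarith
  have h2s : (0 : ℝ) < 2 ^ s := by positivity
  rw [auxT, abs_mul, abs_mul, abs_of_pos h2s, abs_of_pos hG1, abs_div, abs_of_pos hG3]
  set r := |∏ i ∈ Finset.range k, ((i : ℝ) - s)| / Real.Gamma (s + k + 2 * a + 2) with hr
  have hr0 : 0 ≤ r := by positivity
  set p := 2 * γ + 2 * a + 2
  set B := (s + 1 + (γ + 2 * a + 1)) ^ p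
  have hB : 0 ≤ B := by positivity
  calc 2 ^ s * Real.Gamma (s + a + 1) * r * (k : ℝ) ^ p
      ≤ 2 ^ s * Real.Gamma (s + a + 1) * (r * ((k : ℝ) + (γ + 2 * a + 1)) ^ p) := by
        rw [mul_assoc (2 ^ s * Real.Gamma (s + a + 1))]
        gcongr
        linarith
    _ ≤ 2 ^ s * Real.Gamma (s + a + 1) * (B / Real.Gamma (s + 2 * a + 2)) := by gcongr
    _ = 2 ^ s * B * (Real.Gamma (s + a + 1) / Real.Gamma (s + 2 * a + 2)) := by ring
    _ ≤ 2 ^ s * B * 1 := by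
        gcongr
        exact (div_le_one hG2).2 hle
    _ = _ := by ring

lemma aux_rpow_le_exp (p x : ℝ) (hp : 0 < p) (hx : 0 ≤ x) : x ^ p ≤ p ^ p * Real.exp x := by
  have h : x ≤ p * Real.exp (x / p) := by
    have := Real.add_one_le_exp (x / p)
    calc x = p * (x / p) := by field_simp
      _ ≤ p * Real.exp (x / p) := by gcongr; linarith
  calc x ^ p ≤ (p * Real.exp (x / p)) ^ p := by gcongr
    _ = p ^ p * Real.exp x := by
      rw [Real.mul_rpow hp.le (Real.exp_pos _).le, ← Real.exp_mul]
      congr 2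
      field_simp

lemma aux_T_zero (a γ s : ℝ) (ha : 0 ≤ a) (hγ : 0 ≤ γ) (hs : γ < s) :
    Tendsto (fun k : ℕ => auxT a s k * (k : ℝ) ^ (2 * γ + 2 * a + 2)) atTop (𝓝 0) := by
  have hs0 : 0 ≤ s := hγ.trans hs.le
  have h1 : Tendsto (fun k : ℕ => 2 ^ s * (s + 1 + (s + 2 * a + 1)) ^ (2 * s + 2 * a + 2) *
      (k : ℝ) ^ (-(2 * s - 2 * γ))) atTop (𝓝 0) := by
    simpa using ((tendsto_rpow_neg_atTop (by linarith : 0 < 2 * s - 2 * γ)).comp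
      tendsto_natCast_atTop_atTop).const_mul (2 ^ s * (s + 1 + (s + 2 * a + 1)) ^ (2 * s + 2 * a + 2))
  refine squeeze_zero_norm' ?_ h1
  filter_upwards [eventually_ge_atTop 1] with k hk
  have hk' : (0 : ℝ) < k := by exact_mod_cast hk
  have hb := aux_T_bound a s s ha hs0 le_rfl k
  have e : (k : ℝ) ^ (2 * γ + 2 * a + 2) =
      (k : ℝ) ^ (2 * s + 2 * a + 2) * (k : ℝ) ^ (-(2 * s - 2 * γ)) := by
    rw [← Real.rpow_add hk']; congr 1; ring
  rw [norm_mul, Real.norm_eq_abs, Real.norm_eq_abs,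
    abs_of_nonneg (Real.rpow_nonneg hk'.le (2 * γ + 2 * a + 2)), e, ← mul_assoc]
  gcongr

/-- Decay of the Legendre coefficients of the generalized exponential (Laplace-type) kernel
`κ_{c,γ}(u) = exp(-c(1-u)^γ)` on the sphere: `μ_k ∼ C k^{-d-2γ+1}` (with the same limit
along even and odd `k`). -/
theorem generalized_laplace_decay (d : ℕ) (hd : 3 ≤ d) (c γ : ℝ) (hc : 0 < c) (hγ : 0 < γ)
    (hγnonint : ∀ n : ℤ, γ ≠ (n : ℝ)) :
    ∃ C : ℝ, C ≠ 0 ∧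
      Tendsto (fun k : ℕ =>
          legendreCoeff d k (fun u => Real.exp (-c * (1 - u) ^ γ)) *
            (k : ℝ) ^ ((d : ℝ) + 2 * γ - 1))
        atTop (𝓝 C) := by
  have hd' : (3 : ℝ) ≤ d := by exact_mod_cast hd
  obtain ⟨K, hK, hcoef⟩ := aux_coeff d hd c γ hc hγ
  obtain ⟨a, ha_def⟩ : ∃ a : ℝ, a = ((d : ℝ) - 3) / 2 := ⟨_, rfl⟩
  have ha : 0 ≤ a := by rw [ha_def]; linarith
  rw [← ha_def] at hcoef
  obtain ⟨p, hp⟩ : ∃ p : ℝ, p = 2 * γ + 2 * a + 2 := ⟨_, rfl⟩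
  have hp0 : 0 < p := by rw [hp]; positivity
  have hdp : (d : ℝ) + 2 * γ - 1 = p := by rw [hp, ha_def]; ring
  have hG : Real.Gamma (-γ) ≠ 0 := Real.Gamma_ne_zero fun m h => hγnonint m (by simpa using h)
  have hG1 : 0 < Real.Gamma (γ + a + 1) := Real.Gamma_pos_of_pos (by positivity)
  set L : ℝ := -c * (2 ^ γ * Real.Gamma (γ + a + 1) * (1 / Real.Gamma (-γ))) with hL
  have hL0 : L ≠ 0 := by
    have : (2 : ℝ) ^ γ ≠ 0 := by positivity
    have := hG1.ne'
    have := hc.ne'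
    exact mul_ne_zero (neg_ne_zero.2 this) (by positivity)
  refine ⟨K * L, mul_ne_zero hK hL0, ?_⟩
  rw [hdp]
  simp_rw [hcoef]
  have key : Tendsto (fun k : ℕ => ∑' j : ℕ, (-c) ^ j / (j.factorial : ℝ) *
      (auxT a (γ * j) k * (k : ℝ) ^ p)) atTop (𝓝 (∑' j : ℕ, if j = 1 then L else 0)) := by
    set M : ℝ := p ^ p * Real.exp (1 + (γ + 2 * a + 1)) with hM
    refine tendsto_tsum_of_dominated_convergence
      (bound := fun j : ℕ => (c * (2 ^ γ * Real.exp γ)) ^ j / (j.factorial : ℝ) * M)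
      ((Real.summable_pow_div_factorial _).mul_right M) ?_ ?_
    · intro j
      rcases j with _ | _ | j
      · simp only [Nat.cast_zero, mul_zero, zero_ne_one, if_false]
        refine tendsto_const_nhds.congr' ?_
        filter_upwards [eventually_ge_atTop 1] with k hk
        have : ∏ i ∈ Finset.range k, ((i : ℝ) - 0) = 0 :=
          Finset.prod_eq_zero (Finset.mem_range.2 hk) (by simp)
        simp only [auxT]
        rw [this]; simp
      · have h := ((aux_limit γ (γ + 2 * a + 2) (by positivity) hγnonint).const_mul
          (2 ^ γ * Real.Gamma (γ + a + 1))).const_mul (-c)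
        simp only [zero_add, if_true]
        refine h.congr fun k => ?_
        simp only [auxT, Nat.cast_one, mul_one, pow_one, Nat.factorial_one, div_one]
        rw [show γ + 2 * a + 2 + (k : ℝ) = γ + k + 2 * a + 2 by ring,
          show γ + (γ + 2 * a + 2) = p by rw [hp]; ring]
        ring
      · have hlt : γ < γ * ((j + 1 + 1 : ℕ) : ℝ) := by
          push_cast
          have : (0 : ℝ) ≤ j := Nat.cast_nonneg j
          nlinarith
        have h := (aux_T_zero a γ _ ha hγ.le hlt).const_mul
          ((-c) ^ (j + 1 + 1) / ((j + 1 + 1).factorial : ℝ))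
        rw [← hp, mul_zero] at h
        simpa using h
    · filter_upwards [eventually_ge_atTop 1] with k hk j
      have hk' : (0 : ℝ) < k := by exact_mod_cast hk
      have hM0 : 0 ≤ M := by positivity
      rcases Nat.eq_zero_or_pos j with rfl | hj
      · have : ∏ i ∈ Finset.range k, ((i : ℝ) - 0) = 0 :=
          Finset.prod_eq_zero (Finset.mem_range.2 hk) (by simp)
        simp only [auxT, Nat.cast_zero, mul_zero]
        rw [this]; simpa using hM0
      · have hj' : (1 : ℝ) ≤ j := by exact_mod_cast hj
        have hb := aux_T_bound a γ (γ * j) ha hγ.le (by nlinarith) k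
        rw [← hp] at hb
        have hx := aux_rpow_le_exp p (γ * j + 1 + (γ + 2 * a + 1)) hp0 (by positivity)
        rw [norm_mul, norm_mul, Real.norm_eq_abs, Real.norm_eq_abs, Real.norm_eq_abs,
          abs_of_nonneg (Real.rpow_nonneg hk'.le p), abs_div, abs_pow, abs_neg, abs_of_pos hc,
          Nat.abs_cast]
        calc c ^ j / (j.factorial : ℝ) * (|auxT a (γ * j) k| * (k : ℝ) ^ p)
            ≤ c ^ j / (j.factorial : ℝ) * (2 ^ (γ * j) *
                (p ^ p * Real.exp (γ * j + 1 + (γ + 2 * a + 1)))) := by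
              refine mul_le_mul_of_nonneg_left (hb.trans ?_) (by positivity)
              exact mul_le_mul_of_nonneg_left hx (by positivity)
          _ = _ := by
              rw [add_assoc (γ * (j : ℝ)), Real.exp_add (γ * (j : ℝ)), mul_comm γ (j : ℝ),
                Real.exp_nat_mul, mul_comm (j : ℝ) γ, Real.rpow_mul two_pos.le, Real.rpow_natCast,
                hM, mul_pow, mul_pow]
              ring
  rw [tsum_ite_eq] at key
  refine (key.const_mul K).congr fun k => ?_
  rw [mul_assoc, ← tsum_mul_right]
  congr 1
  exact tsum_congr fun j => by ring
end

section
/- Let ν > 0 be a non-integer real, let φ_ν(t) = (1−t²)^ν, and let b_k := φ_ν^{(k)}(0)/k! denote its k-th Taylor coefficient at 0. Then b_k = 0 for every odd k, and there exists a constant C_ν depending only on ν such that for every even k ≥ 0, b_k = C_ν · 2^k · Γ((k+1)/2) · Γ(k/2 − ν) / Γ(k+1). Consequently, there exists a nonzero constant C'_ν depending only on ν such that b_k ∼ C'_ν · k^{−ν−1} as k → ∞ along even k. -/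
open Filter Asymptotics Real Set Topology

/-- Rising product `∏_{j<m} (j-ν)`. -/
noncomputable def risingP (ν : ℝ) (m : ℕ) : ℝ := ∏ j ∈ Finset.range m, (-ν + (j : ℝ))

/-- The explicit Taylor coefficients. -/
noncomputable def coefB (ν : ℝ) (k : ℕ) : ℝ :=
  if Even k then risingP ν (k / 2) / (Nat.factorial (k / 2) : ℝ) else 0

lemma choose_eq_risingP (ν : ℝ) (m : ℕ) :
    Ring.choose ν m * (-1) ^ m = risingP ν m / (Nat.factorial m : ℝ) := by
  have h : ∀ m : ℕ, (descPochhammer ℤ m).smeval ν * (-1) ^ m = risingP ν m := by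
    intro m
    induction m with
    | zero => simp [risingP]
    | succ n ih =>
      have e : risingP ν (n + 1) = risingP ν n * (-ν + n) := by
        simp [risingP, Finset.prod_range_succ]
      rw [e, ← ih, descPochhammer_succ_right, Polynomial.smeval_mul, Polynomial.smeval_sub,
        Polynomial.smeval_X, Polynomial.smeval_natCast]
      simp
      ring
  rw [Ring.choose_eq_smul, ← h, smul_eq_mul]
  field_simp

lemma phi_hasFPowerSeries (ν : ℝ) :
    HasFPowerSeriesAt (fun t : ℝ => (1 - t ^ 2) ^ ν)
      (FormalMultilinearSeries.ofScalars ℝ (coefB ν)) 0 := by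
  have h0 := Real.one_add_rpow_hasFPowerSeriesAt_zero (a := ν)
  rw [hasFPowerSeriesAt_iff] at h0 ⊢
  have ht : Tendsto (fun t : ℝ => -t ^ 2) (𝓝 0) (𝓝 0) := by
    have : Continuous (fun t : ℝ => -t ^ 2) := by fun_prop
    simpa using this.tendsto 0
  filter_upwards [ht.eventually h0] with t h
  have hinj : Function.Injective (fun n : ℕ => 2 * n) := fun a b hab => by
    simpa using hab
  rw [← hinj.hasSum_iff]
  · convert! h using 1
    · funext n
      simp only [Function.comp, FormalMultilinearSeries.coeff_ofScalars, binomialSeries,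
        smul_eq_mul, coefB]
      rw [if_pos (even_two_mul n), Nat.mul_div_cancel_left _ two_pos, ← choose_eq_risingP,
        neg_pow (t ^ 2), pow_mul]
      ring
    · simp [sub_eq_add_neg]
  · intro k hk
    have : ¬ Even k := by
      rintro ⟨r, rfl⟩
      exact hk ⟨r, by simp; ring⟩
    simp [FormalMultilinearSeries.coeff_ofScalars, coefB, this]

lemma taylor_eq (ν : ℝ) (k : ℕ) :
    iteratedDeriv k (fun t : ℝ => (1 - t ^ 2) ^ ν) 0 / (Nat.factorial k : ℝ) = coefB ν k := by
  obtain ⟨r, hr⟩ := phi_hasFPowerSeries ν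
  have := hr.factorial_smul 1 k
  rw [iteratedDeriv_eq_iteratedFDeriv]
  have e : (FormalMultilinearSeries.ofScalars ℝ (coefB ν) k fun _ => (1 : ℝ)) = coefB ν k :=
    FormalMultilinearSeries.coeff_ofScalars (p := coefB ν) (n := k)
  rw [e] at this
  rw [← this, nsmul_eq_mul]
  field_simp

lemma risingP_Gamma (ν : ℝ) (h : ∀ n : ℤ, ν ≠ (n : ℝ)) (m : ℕ) :
    risingP ν m * Real.Gamma (-ν) = Real.Gamma (m - ν) := by
  induction m with
  | zero => simp [risingP]
  | succ n ih =>
    have e : risingP ν (n + 1) = risingP ν n * (-ν + n) := by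
      simp [risingP, Finset.prod_range_succ]
    have hne : (n : ℝ) - ν ≠ 0 := fun h0 => h n (by push_cast; linarith)
    rw [e, show ((n + 1 : ℕ) : ℝ) - ν = (n - ν) + 1 by push_cast; ring,
      Real.Gamma_add_one hne, ← ih]
    ring

lemma Gamma_neg_ne (ν : ℝ) (h : ∀ n : ℤ, ν ≠ (n : ℝ)) : Real.Gamma (-ν) ≠ 0 :=
  Real.Gamma_ne_zero fun m hm => h m (by push_cast; linarith)

lemma coef_closed (ν : ℝ) (h : ∀ n : ℤ, ν ≠ (n : ℝ)) (m : ℕ) :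
    risingP ν m / (Nat.factorial m : ℝ) =
      1 / (√π * Real.Gamma (-ν)) * 2 ^ (2 * m) * Real.Gamma ((((2 * m : ℕ) : ℝ) + 1) / 2) *
        Real.Gamma (((2 * m : ℕ) : ℝ) / 2 - ν) / Real.Gamma (((2 * m : ℕ) : ℝ) + 1) := by
  have hG := Gamma_neg_ne ν h
  have hd := Real.Gamma_mul_Gamma_add_half ((((2 * m : ℕ) : ℝ) + 1) / 2)
  have e1 : (((2 * m : ℕ) : ℝ) + 1) / 2 + 1 / 2 = (m : ℝ) + 1 := by push_cast; ring
  have e2 : 2 * ((((2 * m : ℕ) : ℝ) + 1) / 2) = ((2 * m : ℕ) : ℝ) + 1 := by ring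
  have e3 : (1 : ℝ) - (((2 * m : ℕ) : ℝ) + 1) = -((2 * m : ℕ) : ℝ) := by ring
  rw [e1, e2, e3, Real.Gamma_nat_eq_factorial, Real.rpow_neg two_pos.le, Real.rpow_natCast] at hd
  have e4 : ((2 * m : ℕ) : ℝ) / 2 - ν = m - ν := by push_cast; ring
  rw [e4, ← risingP_Gamma ν h m]
  have hG2 : Real.Gamma (((2 * m : ℕ) : ℝ) + 1) ≠ 0 :=
    (Real.Gamma_pos_of_pos (by positivity)).ne'
  have hpi : √π ≠ 0 := by positivity
  have hf : (Nat.factorial m : ℝ) ≠ 0 := by positivity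
  have hd2 : Real.Gamma ((((2 * m : ℕ) : ℝ) + 1) / 2) =
      Real.Gamma (((2 * m : ℕ) : ℝ) + 1) * (2 ^ (2 * m))⁻¹ * √π / (Nat.factorial m : ℝ) := by
    rw [eq_div_iff hf, hd]
  rw [hd2]
  field_simp

lemma coef_asymp (ν : ℝ) (h : ∀ n : ℤ, ν ≠ (n : ℝ)) :
    Tendsto (fun m : ℕ => risingP ν m / (Nat.factorial m : ℝ) /
      (2 ^ (ν + 1) / Real.Gamma (-ν) * ((2 * m : ℕ) : ℝ) ^ (-ν - 1))) atTop (𝓝 1) := by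
  have hG := Gamma_neg_ne ν h
  have h1 := (Real.GammaSeq_tendsto_Gamma (-ν)).inv₀ hG
  have h2 : Tendsto (fun m : ℕ => (1 - ν / (m : ℝ))⁻¹) atTop (𝓝 1) := by
    have := (tendsto_const_nhds (x := (1 : ℝ))).sub
      (tendsto_const_div_atTop_nhds_zero_nat ν)
    simpa using this.inv₀ (by simp)
  have h3 := (h1.mul h2).mul_const (Real.Gamma (-ν))
  rw [mul_one, inv_mul_cancel₀ hG] at h3
  refine h3.congr' ?_
  filter_upwards [eventually_gt_atTop 0] with m hm
  have hm' : (0 : ℝ) < m := by exact_mod_cast hm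
  have hne : (m : ℝ) - ν ≠ 0 := fun h0 => h m (by push_cast; linarith)
  have e : ∏ j ∈ Finset.range (m + 1), (-ν + (j : ℝ)) = risingP ν m * (m - ν) := by
    rw [Finset.prod_range_succ, risingP]; ring
  have e5 : (1 : ℝ) - ν / m = (m - ν) / m := by field_simp
  have p1 : (((2 * m : ℕ) : ℝ)) ^ (-ν - 1) = (2 ^ (ν + 1))⁻¹ * ((m : ℝ) ^ (-ν) / m) := by
    rw [Nat.cast_mul, Real.mul_rpow (by positivity) hm'.le, Real.rpow_sub_one hm'.ne',
      show -ν - 1 = -(ν + 1) by ring]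
    push_cast
    rw [Real.rpow_neg two_pos.le]
  have p2 : (0 : ℝ) < 2 ^ (ν + 1) := by positivity
  have p3 : (0 : ℝ) < (m : ℝ) ^ (-ν) := by positivity
  rw [Real.GammaSeq, e, e5, p1]
  have hf : (Nat.factorial m : ℝ) ≠ 0 := by positivity
  field_simp


/-- Taylor coefficients of `φ_ν(t) = (1-t²)^ν` at `0`: they vanish for odd `k`, admit a closed
form in terms of Gamma functions for even `k`, and decay as `k^{-ν-1}` along even `k`. -/
theorem taylor_coeffs_phi_nu (ν : ℝ) (hν : 0 < ν) (hνnonint : ∀ n : ℤ, ν ≠ (n : ℝ)) :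
    (∀ k : ℕ, Odd k →
      iteratedDeriv k (fun t : ℝ => (1 - t ^ 2) ^ ν) 0 / (Nat.factorial k : ℝ) = 0) ∧
    ∃ C : ℝ,
      (∀ k : ℕ, Even k →
        iteratedDeriv k (fun t : ℝ => (1 - t ^ 2) ^ ν) 0 / (Nat.factorial k : ℝ) =
          C * 2 ^ k * Real.Gamma (((k : ℝ) + 1) / 2) * Real.Gamma ((k : ℝ) / 2 - ν) /
            Real.Gamma ((k : ℝ) + 1)) ∧
      ∃ C' : ℝ, C' ≠ 0 ∧
        Tendsto (fun k : ℕ =>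
            (iteratedDeriv k (fun t : ℝ => (1 - t ^ 2) ^ ν) 0 / (Nat.factorial k : ℝ)) /
              (C' * (k : ℝ) ^ (-ν - 1)))
          (atTop ⊓ 𝓟 {k | Even k}) (𝓝 1) := by
  simp only [taylor_eq]
  refine ⟨fun k hk => ?_, 1 / (√π * Real.Gamma (-ν)), fun k hk => ?_,
    2 ^ (ν + 1) / Real.Gamma (-ν), ?_, ?_⟩
  · rw [coefB, if_neg (Nat.not_even_iff_odd.mpr hk)]
  · rw [coefB, if_pos hk]
    obtain ⟨m, rfl⟩ := even_iff_two_dvd.mp hk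
    rw [Nat.mul_div_cancel_left _ two_pos]
    exact coef_closed ν hνnonint m
  · have := Gamma_neg_ne ν hνnonint
    positivity
  · have hdiv : Tendsto (fun k : ℕ => k / 2) (atTop ⊓ 𝓟 {k | Even k}) atTop :=
      (Nat.tendsto_div_const_atTop two_ne_zero).mono_left inf_le_left
    refine ((coef_asymp ν hνnonint).comp hdiv).congr' ?_
    have hev : ∀ᶠ k in atTop ⊓ 𝓟 {k : ℕ | Even k}, Even k :=
      mem_inf_of_right (mem_principal_self _)
    filter_upwards [hev] with k hk
    simp only [Function.comp, coefB]
    rw [if_pos hk, Nat.mul_div_cancel' (even_iff_two_dvd.mp hk)]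
end
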